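/- Fix N ≥ 1, initial data θ₁⁰,…,θ_N⁰, ω₁⁰,…,ω_N⁰ ∈ ℝ, natural frequencies ν₁,…,ν_N ∈ ℝ, and κ > 0. For m > 0 let θᵢ(m,t) denote the solution of the inertial Kuramoto model with these data, and let θᵢ(0,t) denote the solution of the first-order Kuramoto model with initial data θ₁⁰,…,θ_N⁰. Then for every integer n ≥ 1, every i ∈ {1,…,N}, and every t ≥ 0, the n-th time derivatives satisfy |θᵢ^{(n)}(m,t) − θᵢ^{(n)}(0,t)| ≤ (n+1)! · 2ⁿ · (κ + max_{j}|ωⱼ⁰| + max_{j}|νⱼ| + 1/m)ⁿ · ((1 + t/m)ⁿ e^{−t/m}(1 + mκ e^{2κt}) + mκ e^{2κt}). -/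

import Mathlib

open Filter Topology MeasureTheory intervalIntegral

noncomputable section

/-- A global smooth solution of the inertial Kuramoto model
`m θ̈ᵢ + θ̇ᵢ = νᵢ + (κ/N) ∑ⱼ sin(θⱼ - θᵢ)` with initial data `θᵢ(0) = θ0 i`,
`θ̇ᵢ(0) = ω0 i`. -/
def IsInertialSol (N : ℕ) (m κ : ℝ) (ν θ0 ω0 : Fin N → ℝ) (θ : Fin N → ℝ → ℝ) : Prop :=
  (∀ i, ContDiff ℝ ⊤ (θ i)) ∧
  (∀ i, θ i 0 = θ0 i) ∧
  (∀ i, deriv (θ i) 0 = ω0 i) ∧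
  (∀ i, ∀ t : ℝ, 0 ≤ t →
    m * deriv (deriv (θ i)) t + deriv (θ i) t
      = ν i + (κ / N) * ∑ j, Real.sin (θ j t - θ i t))

/-- A global smooth solution of the first-order Kuramoto model
`θ̇ᵢ = νᵢ + (κ/N) ∑ⱼ sin(θⱼ - θᵢ)` with initial data `θᵢ(0) = θ0 i`. -/
def IsFirstOrderSol (N : ℕ) (κ : ℝ) (ν θ0 : Fin N → ℝ) (θ : Fin N → ℝ → ℝ) : Prop :=
  (∀ i, ContDiff ℝ (⊤ : ℕ∞) (θ i)) ∧
  (∀ i, θ i 0 = θ0 i) ∧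
  (∀ i, ∀ t : ℝ, 0 ≤ t →
    deriv (θ i) t = ν i + (κ / N) * ∑ j, Real.sin (θ j t - θ i t))

/-- The coupling term. -/
def kurP (N : ℕ) (κ : ℝ) (θ : Fin N → ℝ → ℝ) (i : Fin N) (t : ℝ) : ℝ :=
  (κ / N) * ∑ j, Real.sin (θ j t - θ i t)

lemma smooth_diff_iter {f : ℝ → ℝ} (hf : ContDiff ℝ (⊤ : ℕ∞) f) (n : ℕ) :
    Differentiable ℝ (iteratedDeriv n f) := by
  apply hf.differentiable_iteratedDeriv n
  exact_mod_cast ENat.natCast_lt_top n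

lemma deriv_eq_of_eqOn {f g : ℝ → ℝ} (hf : Differentiable ℝ f) (hg : Differentiable ℝ g)
    (h : ∀ t, 0 ≤ t → f t = g t) : ∀ t, 0 ≤ t → deriv f t = deriv g t := by
  intro t ht
  have h1 : HasDerivWithinAt f (deriv f t) (Set.Ici 0) t := (hf t).hasDerivAt.hasDerivWithinAt
  have h2 : HasDerivWithinAt g (deriv g t) (Set.Ici 0) t := (hg t).hasDerivAt.hasDerivWithinAt
  have h3 : HasDerivWithinAt f (deriv g t) (Set.Ici 0) t :=
    h2.congr (fun x hx => h x hx) (h t ht)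
  exact (uniqueDiffOn_Ici (0 : ℝ) t ht).eq_deriv _ h1 h3

lemma iter_eq_of_eqOn {f g : ℝ → ℝ} (hf : ContDiff ℝ (⊤ : ℕ∞) f) (hg : ContDiff ℝ (⊤ : ℕ∞) g)
    (h : ∀ t, 0 ≤ t → f t = g t) (n : ℕ) :
    ∀ t, 0 ≤ t → iteratedDeriv n f t = iteratedDeriv n g t := by
  induction n with
  | zero => simpa using h
  | succ n ih =>
    rw [iteratedDeriv_succ, iteratedDeriv_succ]
    exact deriv_eq_of_eqOn (smooth_diff_iter hf n) (smooth_diff_iter hg n) ih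

lemma lin_upper {m c : ℝ} (hm : 0 < m) {y : ℝ → ℝ} (hy : Differentiable ℝ y)
    (h : ∀ t, 0 ≤ t → m * deriv y t + y t ≤ c) (t : ℝ) (ht : 0 ≤ t) :
    y t ≤ y 0 * Real.exp (-t / m) + c * (1 - Real.exp (-t / m)) := by
  have hd : ∀ s, HasDerivAt (fun s => Real.exp (s / m) * (y s - c))
      (Real.exp (s / m) * (1 / m) * (y s - c) + Real.exp (s / m) * deriv y s) s := by
    intro s
    have h1 : HasDerivAt (fun s => Real.exp (s / m)) (Real.exp (s / m) * (1 / m)) s :=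
      ((hasDerivAt_id s).div_const m).exp
    exact h1.mul ((hy s).hasDerivAt.sub_const c)
  have hanti : AntitoneOn (fun s => Real.exp (s / m) * (y s - c)) (Set.Ici 0) := by
    apply antitoneOn_of_deriv_nonpos (convex_Ici 0)
    · exact fun s _ => (hd s).continuousAt.continuousWithinAt
    · exact fun s _ => (hd s).differentiableAt.differentiableWithinAt
    · intro s hs
      rw [interior_Ici] at hs
      rw [(hd s).deriv]
      have e : Real.exp (s / m) * (1 / m) * (y s - c) + Real.exp (s / m) * deriv y s
        = (Real.exp (s / m) / m) * (m * deriv y s + y s - c) := by field_simp; ring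
      rw [e]
      apply mul_nonpos_of_nonneg_of_nonpos (by positivity)
      linarith [h s (le_of_lt hs)]
  have h2 := hanti (Set.mem_Ici.2 le_rfl) (Set.mem_Ici.2 ht) ht
  simp only [zero_div, Real.exp_zero, one_mul] at h2
  have h3 : Real.exp (-t / m) * Real.exp (t / m) = 1 := by
    rw [← Real.exp_add]; simp [neg_div]
  have h4 := mul_le_mul_of_nonneg_left h2 (Real.exp_pos (-t / m)).le
  rw [← mul_assoc, h3] at h4
  linarith

lemma lin_abs {m c : ℝ} (hm : 0 < m) {y : ℝ → ℝ} (hy : Differentiable ℝ y)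
    (h : ∀ t, 0 ≤ t → |m * deriv y t + y t| ≤ c) (t : ℝ) (ht : 0 ≤ t) :
    |y t| ≤ |y 0| * Real.exp (-t / m) + c * (1 - Real.exp (-t / m)) := by
  have h1 := lin_upper hm hy (fun t ht => (abs_le.1 (h t ht)).2) t ht
  have h2 := lin_upper (c := c) hm hy.neg (fun t ht => by
    have := (abs_le.1 (h t ht)).1
    simp only [deriv.neg, Pi.neg_apply]
    linarith) t ht
  simp only [Pi.neg_apply] at h2
  have he := (Real.exp_pos (-t / m)).le
  have h3 := mul_le_mul_of_nonneg_right (le_abs_self (y 0)) he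
  have h4 := mul_le_mul_of_nonneg_right (neg_le_abs (y 0)) he
  rw [abs_le]
  constructor <;> linarith

lemma lin_max {m c : ℝ} (hm : 0 < m) {y : ℝ → ℝ} (hy : Differentiable ℝ y)
    (h : ∀ t, 0 ≤ t → |m * deriv y t + y t| ≤ c) (h0 : |y 0| ≤ c) (t : ℝ) (ht : 0 ≤ t) :
    |y t| ≤ c := by
  have h1 := lin_abs hm hy h t ht
  have h3 := mul_le_mul_of_nonneg_right h0 (Real.exp_pos (-t / m)).le
  linarith

lemma lin_weak {m c : ℝ} (hm : 0 < m) {y : ℝ → ℝ} (hy : Differentiable ℝ y)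
    (h : ∀ t, 0 ≤ t → |m * deriv y t + y t| ≤ c) (t : ℝ) (ht : 0 ≤ t) :
    |y t| ≤ |y 0| * Real.exp (-t / m) + c := by
  have h1 := lin_abs hm hy h t ht
  have hc : 0 ≤ c := (abs_nonneg _).trans (h t ht)
  have h3 := mul_nonneg hc (Real.exp_pos (-t / m)).le
  linarith

lemma prod_bound {A t : ℝ} (hA : 0 ≤ A) {f g : ℝ → ℝ} (hf : ContDiff ℝ (⊤ : ℕ∞) f)
    (hg : ContDiff ℝ (⊤ : ℕ∞) g) (n : ℕ)
    (h1 : ∀ k ≤ n, |iteratedDeriv k f t| ≤ 2 * ((k.factorial : ℝ) * 2 ^ k * A ^ (k + 1)))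
    (h2 : ∀ k ≤ n, |iteratedDeriv k g t| ≤ (k.factorial : ℝ) * (2 * A) ^ k) :
    |iteratedDeriv n (f * g) t| ≤ ((n + 1).factorial : ℝ) * (2 * A) ^ (n + 1) := by
  rw [iteratedDeriv_mul ((hf.of_le (by exact_mod_cast le_top)).contDiffAt)
    ((hg.of_le (by exact_mod_cast le_top)).contDiffAt)]
  calc _ ≤ ∑ k ∈ Finset.range (n + 1),
        |(n.choose k : ℝ) * iteratedDeriv k f t * iteratedDeriv (n - k) g t| :=
        Finset.abs_sum_le_sum_abs _ _
    _ ≤ ∑ k ∈ Finset.range (n + 1), (n.factorial : ℝ) * (2 * A) ^ (n + 1) := by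
        apply Finset.sum_le_sum
        intro k hk
        have hk' : k ≤ n := by simpa [Nat.lt_succ_iff] using hk
        rw [abs_mul, abs_mul, Nat.abs_cast]
        calc _ ≤ (n.choose k : ℝ) * (2 * ((k.factorial : ℝ) * 2 ^ k * A ^ (k + 1))) *
              (((n - k).factorial : ℝ) * (2 * A) ^ (n - k)) := by
              gcongr
              · exact h1 k hk'
              · exact h2 _ (Nat.sub_le _ _)
          _ = ((n.choose k * k.factorial * (n - k).factorial : ℕ) : ℝ) *
              (2 * A) ^ (k + 1 + (n - k)) := by
              push_cast
              rw [pow_add (2 * A) (k + 1), pow_succ (2 * A) k, pow_succ A k, mul_pow 2 A k]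
              ring
          _ = _ := by
              rw [Nat.choose_mul_factorial_mul_factorial hk']
              congr 2; omega
    _ = _ := by
        rw [Finset.sum_const, Finset.card_range, Nat.factorial_succ]
        push_cast
        simp only [nsmul_eq_mul]
        push_cast
        ring

lemma sincos_bound {A t : ℝ} (hA : 0 ≤ A) {f : ℝ → ℝ} (hf : ContDiff ℝ (⊤ : ℕ∞) f) (n : ℕ)
    (h1 : ∀ k < n, |iteratedDeriv (k + 1) f t| ≤ 2 * ((k.factorial : ℝ) * 2 ^ k * A ^ (k + 1))) :
    |iteratedDeriv n (fun s => Real.sin (f s)) t| ≤ (n.factorial : ℝ) * (2 * A) ^ n ∧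
    |iteratedDeriv n (fun s => Real.cos (f s)) t| ≤ (n.factorial : ℝ) * (2 * A) ^ n := by
  induction n using Nat.strong_induction_on with
  | _ n ih =>
    cases n with
    | zero => simpa using ⟨Real.abs_sin_le_one _, Real.abs_cos_le_one _⟩
    | succ n =>
      have hd : Differentiable ℝ f := hf.differentiable (by simp)
      have hfd : ContDiff ℝ (⊤ : ℕ∞) (deriv f) := by
        have : ContDiff ℝ ((⊤ : ℕ∞) + 1) f := hf
        exact (contDiff_succ_iff_deriv.1 this).2.2
      have hs : deriv (fun s => Real.sin (f s)) = deriv f * (fun s => Real.cos (f s)) := by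
        funext s
        simp only [Pi.mul_apply]
        rw [((hd s).hasDerivAt.sin).deriv]; ring
      have hc : deriv (fun s => Real.cos (f s)) = -(deriv f * (fun s => Real.sin (f s))) := by
        funext s
        simp only [Pi.mul_apply, Pi.neg_apply]
        rw [((hd s).hasDerivAt.cos).deriv]; ring
      have h1' : ∀ k ≤ n, |iteratedDeriv k (deriv f) t| ≤
          2 * ((k.factorial : ℝ) * 2 ^ k * A ^ (k + 1)) := by
        intro k hk
        rw [← iteratedDeriv_succ']
        exact h1 k (by omega)
      have ih' : ∀ k ≤ n, _ := fun k hk => ih k (by omega) (fun l hl => h1 l (by omega))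
      rw [iteratedDeriv_succ', iteratedDeriv_succ', hs, hc, iteratedDeriv_neg, abs_neg]
      exact ⟨prod_bound hA hfd (Real.contDiff_cos.comp hf) n h1' (fun k hk => (ih' k hk).2),
        prod_bound hA hfd (Real.contDiff_sin.comp hf) n h1' (fun k hk => (ih' k hk).1)⟩

lemma kurP_smooth {N : ℕ} {κ : ℝ} {θ : Fin N → ℝ → ℝ} (h : ∀ i, ContDiff ℝ (⊤ : ℕ∞) (θ i))
    (i : Fin N) : ContDiff ℝ (⊤ : ℕ∞) (kurP N κ θ i) := by
  unfold kurP
  exact contDiff_const.mul (ContDiff.sum fun j _ => Real.contDiff_sin.comp ((h j).sub (h i)))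

lemma kurP_bound {N : ℕ} {κ A t : ℝ} (hN : 1 ≤ N) (hκ : 0 < κ) (hA : 0 ≤ A)
    {θ : Fin N → ℝ → ℝ} (h : ∀ i, ContDiff ℝ (⊤ : ℕ∞) (θ i)) (n : ℕ)
    (hb : ∀ k < n, ∀ i, |iteratedDeriv (k + 1) (θ i) t| ≤ (k.factorial : ℝ) * 2 ^ k * A ^ (k + 1))
    (i : Fin N) :
    |iteratedDeriv n (kurP N κ θ i) t| ≤ κ * ((n.factorial : ℝ) * (2 * A) ^ n) := by
  have hN' : (0 : ℝ) < N := by exact_mod_cast hN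
  have hsm : ∀ j, ContDiff ℝ (⊤ : ℕ∞) (fun s => Real.sin (θ j s - θ i s)) :=
    fun j => Real.contDiff_sin.comp ((h j).sub (h i))
  unfold kurP
  rw [iteratedDeriv_const_mul_field, iteratedDeriv_fun_sum
    (fun j _ => ((hsm j).of_le (by exact_mod_cast le_top)).contDiffAt), abs_mul,
    abs_of_pos (div_pos hκ hN')]
  have hj : ∀ j, |iteratedDeriv n (fun s => Real.sin (θ j s - θ i s)) t| ≤
      (n.factorial : ℝ) * (2 * A) ^ n := by
    intro j
    refine (sincos_bound hA ((h j).sub (h i)) n ?_).1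
    intro k hk
    have : iteratedDeriv (k + 1) (fun s => θ j s - θ i s) t =
        iteratedDeriv (k + 1) (θ j) t - iteratedDeriv (k + 1) (θ i) t :=
      iteratedDeriv_sub (((h j).of_le (by exact_mod_cast le_top)).contDiffAt)
        (((h i).of_le (by exact_mod_cast le_top)).contDiffAt)
    rw [this]
    refine (abs_sub _ _).trans ?_
    linarith [hb k hk j, hb k hk i]
  have hsum : |∑ j, iteratedDeriv n (fun s => Real.sin (θ j s - θ i s)) t| ≤
      N * ((n.factorial : ℝ) * (2 * A) ^ n) := by
    refine (Finset.abs_sum_le_sum_abs _ _).trans ?_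
    refine (Finset.sum_le_sum (fun j _ => hj j)).trans ?_
    simp
  calc _ ≤ κ / N * (N * ((n.factorial : ℝ) * (2 * A) ^ n)) := by gcongr
    _ = _ := by field_simp

lemma kurP_lip {N : ℕ} {κ D t : ℝ} (hN : 1 ≤ N) (hκ : 0 < κ)
    {θ η : Fin N → ℝ → ℝ} (hb : ∀ i, |θ i t - η i t| ≤ D) (i : Fin N) :
    |kurP N κ θ i t - kurP N κ η i t| ≤ 2 * κ * D := by
  have hN' : (0 : ℝ) < N := by exact_mod_cast hN
  unfold kurP
  rw [← mul_sub, ← Finset.sum_sub_distrib, abs_mul, abs_of_pos (div_pos hκ hN')]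
  have hj : ∀ j, |Real.sin (θ j t - θ i t) - Real.sin (η j t - η i t)| ≤ 2 * D := by
    intro j
    have h1 : |Real.sin (θ j t - θ i t) - Real.sin (η j t - η i t)| ≤
        |(θ j t - θ i t) - (η j t - η i t)| := by
      have := Real.lipschitzWith_sin.dist_le_mul (θ j t - θ i t) (η j t - η i t)
      simpa only [Real.dist_eq, NNReal.coe_one, one_mul] using this
    have h2 : |(θ j t - θ i t) - (η j t - η i t)| ≤ |θ j t - η j t| + |θ i t - η i t| := by
      have := abs_sub (θ j t - η j t) (θ i t - η i t)
      have e : (θ j t - θ i t) - (η j t - η i t) = (θ j t - η j t) - (θ i t - η i t) := by ring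
      rw [e]; exact this
    linarith [hb j, hb i]
  have hsum : |∑ j, (Real.sin (θ j t - θ i t) - Real.sin (η j t - η i t))| ≤ N * (2 * D) := by
    refine (Finset.abs_sum_le_sum_abs _ _).trans ?_
    refine (Finset.sum_le_sum (fun j _ => hj j)).trans ?_
    simp
  calc _ ≤ κ / N * (N * (2 * D)) := by gcongr
    _ = _ := by field_simp

lemma first_bound {N : ℕ} {κ V A : ℝ} (hN : 1 ≤ N) (hκ : 0 < κ) (hκA : κ ≤ A) (hVA : V + κ ≤ A)
    {ν : Fin N → ℝ} (hV : ∀ j, |ν j| ≤ V)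
    {θ : Fin N → ℝ → ℝ} (h : ∀ i, ContDiff ℝ (⊤ : ℕ∞) (θ i))
    (he : ∀ i, ∀ t, 0 ≤ t → deriv (θ i) t = ν i + kurP N κ θ i t) (k : ℕ) :
    ∀ i, ∀ t, 0 ≤ t → |iteratedDeriv (k + 1) (θ i) t| ≤ (k.factorial : ℝ) * 2 ^ k * A ^ (k + 1) ∧
      (1 ≤ k → |iteratedDeriv (k + 1) (θ i) t| ≤ κ * ((k.factorial : ℝ) * (2 * A) ^ k)) := by
  induction k using Nat.strong_induction_on with
  | _ k ih =>
    intro i t ht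
    have hA : 0 ≤ A := hκ.le.trans hκA
    have hP := kurP_bound (t := t) hN hκ hA h k (fun l hl j => (ih l hl j t ht).1) i
    have hder : ContDiff ℝ (⊤ : ℕ∞) (deriv (θ i)) :=
      (contDiff_succ_iff_deriv.1 (show ContDiff ℝ ((⊤ : ℕ∞) + 1) (θ i) from h i)).2.2
    have e : iteratedDeriv (k + 1) (θ i) t = iteratedDeriv k (fun s => ν i + kurP N κ θ i s) t := by
      rw [iteratedDeriv_succ']
      exact iter_eq_of_eqOn hder (contDiff_const.add (kurP_smooth h i)) (he i) k t ht
    rw [e]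
    cases k with
    | zero =>
      simp only [iteratedDeriv_zero, Nat.factorial_zero, pow_zero] at hP ⊢
      refine ⟨?_, by omega⟩
      have := abs_add_le (ν i) (kurP N κ θ i t)
      norm_num at hP ⊢
      linarith [hV i]
    | succ k =>
      rw [iteratedDeriv_const_add (by omega)]
      refine ⟨hP.trans ?_, fun _ => hP⟩
      calc _ ≤ A * (((k + 1).factorial : ℝ) * (2 * A) ^ (k + 1)) := by gcongr
        _ = _ := by rw [mul_pow]; ring

lemma inert_eq {N : ℕ} {κ m : ℝ} 
    {ν : Fin N → ℝ} 
    {θ : Fin N → ℝ → ℝ} (h : ∀ i, ContDiff ℝ (⊤ : ℕ∞) (θ i))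
    (he : ∀ i, ∀ t, 0 ≤ t → m * deriv (deriv (θ i)) t + deriv (θ i) t = ν i + kurP N κ θ i t)
    (k : ℕ) (i : Fin N) (t : ℝ) (ht : 0 ≤ t) :
    m * iteratedDeriv (k + 2) (θ i) t + iteratedDeriv (k + 1) (θ i) t =
      iteratedDeriv k (fun s => ν i + kurP N κ θ i s) t := by
  have hder : ContDiff ℝ (⊤ : ℕ∞) (deriv (θ i)) :=
    (contDiff_succ_iff_deriv.1 (show ContDiff ℝ ((⊤ : ℕ∞) + 1) (θ i) from h i)).2.2
  have hder2 : ContDiff ℝ (⊤ : ℕ∞) (deriv (deriv (θ i))) :=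
    (contDiff_succ_iff_deriv.1 (show ContDiff ℝ ((⊤ : ℕ∞) + 1) (deriv (θ i)) from hder)).2.2
  have h1 := iter_eq_of_eqOn (f := (fun s => m * deriv (deriv (θ i)) s) + deriv (θ i))
    ((contDiff_const.mul hder2).add hder)
    (contDiff_const.add (kurP_smooth h i)) (he i) k t ht
  rw [← h1, iteratedDeriv_add
    (((contDiff_const.mul hder2).of_le (by exact_mod_cast le_top)).contDiffAt)
    ((hder.of_le (by exact_mod_cast le_top)).contDiffAt), iteratedDeriv_const_mul_field,
    ← iteratedDeriv_succ', ← iteratedDeriv_succ', ← iteratedDeriv_succ']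

lemma inert_bound {N : ℕ} {κ V W A m : ℝ} (hN : 1 ≤ N) (hκ : 0 < κ) (hm : 0 < m)
    (hκA : κ ≤ A) (hVA : V + κ ≤ A) (hWA : W ≤ A) (hmA : 1 / m ≤ A)
    {ν : Fin N → ℝ} (hV : ∀ j, |ν j| ≤ V)
    {θ : Fin N → ℝ → ℝ} (h : ∀ i, ContDiff ℝ (⊤ : ℕ∞) (θ i))
    (h0 : ∀ i, |deriv (θ i) 0| ≤ W)
    (he : ∀ i, ∀ t, 0 ≤ t → m * deriv (deriv (θ i)) t + deriv (θ i) t = ν i + kurP N κ θ i t)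
    (k : ℕ) :
    ∀ i, ∀ t, 0 ≤ t → |iteratedDeriv (k + 1) (θ i) t| ≤ (k.factorial : ℝ) * 2 ^ k * A ^ (k + 1) ∧
      (1 ≤ k → |iteratedDeriv (k + 1) (θ i) t| ≤
        (k.factorial : ℝ) * 2 ^ k * A ^ (k + 1) * Real.exp (-t / m) +
        κ * ((k.factorial : ℝ) * (2 * A) ^ k)) := by
  have hA : 0 ≤ A := hκ.le.trans hκA
  have hF0 : ∀ i t, |ν i + kurP N κ θ i t| ≤ A := by
    intro i t
    have hP := kurP_bound (t := t) hN hκ hA h 0 (by omega) i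
    have := abs_add_le (ν i) (kurP N κ θ i t)
    norm_num at hP
    linarith [hV i]
  induction k using Nat.strong_induction_on with
  | _ k ih =>
    intro i t ht
    have hP : ∀ t, 0 ≤ t → |iteratedDeriv k (kurP N κ θ i) t| ≤ _ := fun t ht =>
      kurP_bound (t := t) hN hκ hA h k (fun l hl j => (ih l hl j t ht).1) i
    have hdiff := smooth_diff_iter (h i) (k + 1)
    have heq : ∀ t, 0 ≤ t → m * deriv (iteratedDeriv (k + 1) (θ i)) t +
        iteratedDeriv (k + 1) (θ i) t = iteratedDeriv k (fun s => ν i + kurP N κ θ i s) t := by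
      intro t ht
      rw [← iteratedDeriv_succ]
      exact inert_eq h he k i t ht
    cases k with
    | zero =>
      refine ⟨?_, by omega⟩
      have := lin_max (c := A) hm hdiff (fun t ht => by
        rw [heq t ht]; exact hF0 i t) (by simpa using (h0 i).trans hWA) t ht
      simpa using this
    | succ k =>
      have hg : ∀ t, 0 ≤ t → |m * deriv (iteratedDeriv (k + 1 + 1) (θ i)) t +
          iteratedDeriv (k + 1 + 1) (θ i) t| ≤ κ * (((k + 1).factorial : ℝ) * (2 * A) ^ (k + 1)) := by
        intro t ht
        rw [heq t ht, iteratedDeriv_const_add (by omega)]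
        exact hP t ht
      have hF : |iteratedDeriv k (fun s => ν i + kurP N κ θ i s) 0| ≤
          (k.factorial : ℝ) * 2 ^ k * A ^ (k + 1) := by
        cases k with
        | zero => simpa using hF0 i 0
        | succ k =>
          rw [iteratedDeriv_const_add (by omega)]
          refine (kurP_bound (t := 0) hN hκ hA h (k + 1)
            (fun l hl j => (ih l (by omega) j 0 le_rfl).1) i).trans ?_
          calc _ ≤ A * (((k + 1).factorial : ℝ) * (2 * A) ^ (k + 1)) := by gcongr
            _ = _ := by rw [mul_pow]; ring
      have hini : |iteratedDeriv (k + 1 + 1) (θ i) 0| ≤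
          ((k + 1).factorial : ℝ) * 2 ^ (k + 1) * A ^ (k + 1 + 1) := by
        have e := inert_eq h he k i 0 le_rfl
        have e2 : iteratedDeriv (k + 1 + 1) (θ i) 0 =
          (1 / m) * (iteratedDeriv k (fun s => ν i + kurP N κ θ i s) 0 -
            iteratedDeriv (k + 1) (θ i) 0) := by
          rw [← e]; field_simp; ring
        rw [e2, abs_mul, abs_of_pos (by positivity : 0 < 1 / m)]
        have hb := (ih k (by omega) i 0 le_rfl).1
        have hs := (abs_sub (iteratedDeriv k (fun s => ν i + kurP N κ θ i s) 0)
          (iteratedDeriv (k + 1) (θ i) 0)).trans (add_le_add hF hb)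
        calc _ ≤ A * ((k.factorial : ℝ) * 2 ^ k * A ^ (k + 1) +
              (k.factorial : ℝ) * 2 ^ k * A ^ (k + 1)) := by gcongr
          _ = 1 * ((k.factorial : ℝ) * 2 ^ (k + 1) * A ^ (k + 1 + 1)) := by ring
          _ ≤ ((k : ℝ) + 1) * ((k.factorial : ℝ) * 2 ^ (k + 1) * A ^ (k + 1 + 1)) := by
            gcongr; linarith [(Nat.cast_nonneg k : (0 : ℝ) ≤ k)]
          _ = _ := by rw [Nat.factorial_succ]; push_cast; ring
      have hk1 : κ * (((k + 1).factorial : ℝ) * (2 * A) ^ (k + 1)) ≤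
          ((k + 1).factorial : ℝ) * 2 ^ (k + 1) * A ^ (k + 1 + 1) := by
        calc _ ≤ A * (((k + 1).factorial : ℝ) * (2 * A) ^ (k + 1)) := by gcongr
          _ = _ := by rw [mul_pow]; ring
      refine ⟨lin_max hm hdiff (fun t ht => (hg t ht).trans hk1) hini t ht, fun _ => ?_⟩
      refine (lin_weak hm hdiff hg t ht).trans ?_
      gcongr

/-- Zeroth order estimate by Gronwall. -/
lemma zeroth {N : ℕ} {κ C m : ℝ} (hN : 1 ≤ N) (hκ : 0 < κ) (hC : 0 ≤ C) (hm : 0 < m)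
    {ν : Fin N → ℝ} {θ η : Fin N → ℝ → ℝ}
    (h : ∀ i, ContDiff ℝ (⊤ : ℕ∞) (θ i)) (h' : ∀ i, ContDiff ℝ (⊤ : ℕ∞) (η i))
    (h0 : ∀ i, θ i 0 = η i 0)
    (hC' : ∀ i t, |ν i + kurP N κ θ i t - deriv (θ i) 0| ≤ C)
    (he : ∀ i, ∀ t, 0 ≤ t → m * deriv (deriv (θ i)) t + deriv (θ i) t = ν i + kurP N κ θ i t)
    (he' : ∀ i, ∀ t, 0 ≤ t → deriv (η i) t = ν i + kurP N κ η i t)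
    (t : ℝ) (ht : 0 ≤ t) (i : Fin N) :
    |θ i t - η i t| ≤ m * C * Real.exp (2 * κ * t) := by
  have hdd : ∀ i, Differentiable ℝ (deriv (θ i)) := by
    intro i
    have := smooth_diff_iter (h i) 1
    rwa [iteratedDeriv_one] at this
  have hd : ∀ i, Differentiable ℝ (θ i) := fun i => (h i).differentiable (by simp)
  have hd' : ∀ i, Differentiable ℝ (η i) := fun i => (h' i).differentiable (by simp)
  have hω : ∀ i t, 0 ≤ t → |deriv (θ i) t - deriv (θ i) 0| ≤ C := by
    intro i t ht
    refine lin_max (y := fun t => deriv (θ i) t - deriv (θ i) 0) hm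
      ((hdd i).sub_const _) ?_ (by simpa using hC) t ht
    intro t ht
    have : deriv (fun t => deriv (θ i) t - deriv (θ i) 0) t = deriv (deriv (θ i)) t := by
      rw [deriv_sub_const]
    rw [this]
    have := hC' i t
    rw [← he i t ht] at this
    convert this using 2; ring
  let f : ℝ → Fin N → ℝ := fun s j => θ j s - η j s + m * (deriv (θ j) s - deriv (θ j) 0)
  let f' : ℝ → Fin N → ℝ := fun s j => deriv (θ j) s - deriv (η j) s + m * deriv (deriv (θ j)) s
  have hf : ∀ s, HasDerivAt f (f' s) s := by
    intro s
    rw [hasDerivAt_pi]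
    intro j
    exact ((hd j s).hasDerivAt.sub (hd' j s).hasDerivAt).add
      (((hdd j s).hasDerivAt.sub_const _).const_mul m)
  have hD : ∀ s, 0 ≤ s → ∀ j, |θ j s - η j s| ≤ ‖f s‖ + m * C := by
    intro s hs j
    have h1 : |f s j| ≤ ‖f s‖ := norm_le_pi_norm (f s) j
    have h2 := abs_sub (f s j) (m * (deriv (θ j) s - deriv (θ j) 0))
    rw [abs_mul, abs_of_pos hm] at h2
    have h3 := mul_le_mul_of_nonneg_left (hω j s hs) hm.le
    have e : f s j - m * (deriv (θ j) s - deriv (θ j) 0) = θ j s - η j s := by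
      simp only [f]; ring
    rw [e] at h2
    linarith
  have hg := norm_le_gronwallBound_of_norm_deriv_right_le (f := f) (f' := f') (δ := 0)
    (K := 2 * κ) (ε := 2 * κ * (m * C)) (a := 0) (b := t)
    (fun s _ => (hf s).continuousAt.continuousWithinAt)
    (fun s _ => (hf s).hasDerivWithinAt)
    (by
      have : f 0 = 0 := by funext j; simp [f, h0 j]
      rw [this]; simp)
    (by
      intro s hs
      have hs0 : 0 ≤ s := hs.1
      rw [← mul_add]
      rw [pi_norm_le_iff_of_nonneg (by positivity)]
      intro j
      have := kurP_lip hN hκ (hD s hs0) j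
      rw [Real.norm_eq_abs]
      convert this using 2
      simp only [f']
      linarith [he j s hs0, he' j s hs0])
    t ⟨ht, le_rfl⟩
  rw [gronwallBound_of_K_ne_0 (by positivity)] at hg
  simp only [zero_mul, sub_zero, zero_add] at hg
  rw [mul_div_cancel_left₀ _ (by positivity : 2 * κ ≠ 0)] at hg
  have := hD t ht i
  linarith

/-- Theorem 1.4 (2): quantitative higher-order Tikhonov bound for the `n`-th
time derivatives in the zero inertia limit. -/
theorem stmt2 (N : ℕ) (hN : 1 ≤ N) (θ0 ω0 ν : Fin N → ℝ) (κ m : ℝ)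
    (hκ : 0 < κ) (hm : 0 < m)
    (θm θz : Fin N → ℝ → ℝ)
    (hθm : IsInertialSol N m κ ν θ0 ω0 θm)
    (hθz : IsFirstOrderSol N κ ν θ0 θz) :
    ∀ n : ℕ, 1 ≤ n → ∀ i, ∀ t : ℝ, 0 ≤ t →
      |iteratedDeriv n (θm i) t - iteratedDeriv n (θz i) t| ≤
        (Nat.factorial (n + 1) : ℝ) * 2 ^ n *
          (κ + (⨆ j, |ω0 j|) + (⨆ j, |ν j|) + 1 / m) ^ n *
          ((1 + t / m) ^ n * Real.exp (-t / m) * (1 + m * κ * Real.exp (2 * κ * t)) +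
            m * κ * Real.exp (2 * κ * t)) := by
  obtain ⟨hs', hi, hw, he0⟩ := hθm
  obtain ⟨hsz, hiz, hez0⟩ := hθz
  have hs : ∀ i, ContDiff ℝ (⊤ : ℕ∞) (θm i) := fun i => (hs' i).of_le le_top
  have he : ∀ i, ∀ t, 0 ≤ t → m * deriv (deriv (θm i)) t + deriv (θm i) t =
    ν i + kurP N κ θm i t := he0
  have hez : ∀ i, ∀ t, 0 ≤ t → deriv (θz i) t = ν i + kurP N κ θz i t := hez0
  intro n hn i t ht
  have hW : ∀ j, |ω0 j| ≤ ⨆ j, |ω0 j| := fun j =>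
    le_ciSup (f := fun j => |ω0 j|) (Set.finite_range _).bddAbove j
  have hV : ∀ j, |ν j| ≤ ⨆ j, |ν j| := fun j =>
    le_ciSup (f := fun j => |ν j|) (Set.finite_range _).bddAbove j
  generalize (⨆ j, |ω0 j|) = W at *
  generalize (⨆ j, |ν j|) = V at *
  have hW0 : 0 ≤ W := (abs_nonneg _).trans (hW i)
  have hV0 : 0 ≤ V := (abs_nonneg _).trans (hV i)
  have hm1 : 0 < 1 / m := by positivity
  obtain ⟨A, hAdef⟩ : ∃ A, A = κ + W + V + 1 / m := ⟨_, rfl⟩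
  rw [← hAdef]
  have hA : 0 < A := by rw [hAdef]; positivity
  have hmA : 1 ≤ m * A := by
    have : m * (1 / m) ≤ m * A := by gcongr; linarith
    rwa [mul_one_div_cancel hm.ne'] at this
  have hw' : ∀ i, |deriv (θm i) 0| ≤ W := fun i => by rw [hw i]; exact hW i
  have bm := fun k => inert_bound (A := A) (W := W) hN hκ hm (by linarith) (by linarith)
    (by linarith) (by linarith) hV hs hw' he k
  have bz := fun k => first_bound (A := A) hN hκ (by linarith) (by linarith) hV hsz hez k
  have hE : 1 ≤ Real.exp (2 * κ * t) := Real.one_le_exp (by positivity)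
  have hx : 0 < Real.exp (-t / m) := Real.exp_pos _
  have htm : 1 ≤ 1 + t / m := by
    have : 0 ≤ t / m := by positivity
    linarith
  generalize hEd : Real.exp (2 * κ * t) = E at *
  have hmE : m * κ ≤ m * κ * E := le_mul_of_one_le_right (by positivity) hE
  have hmE0 : 0 < m * κ := by positivity
  have hbr : Real.exp (-t / m) + m * κ * E ≤
      (1 + t / m) ^ n * Real.exp (-t / m) * (1 + m * κ * E) + m * κ * E := by
    gcongr
    calc Real.exp (-t / m) = 1 * Real.exp (-t / m) * 1 := by ring
      _ ≤ (1 + t / m) ^ n * Real.exp (-t / m) * (1 + m * κ * E) := by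
        gcongr
        · exact one_le_pow₀ htm
        · linarith
  refine le_trans ?_ (mul_le_mul_of_nonneg_left hbr (by positivity))
  obtain ⟨k, rfl⟩ : ∃ k, n = k + 1 := ⟨n - 1, by omega⟩
  cases k with
  | zero =>
    have hC' : ∀ i t, |ν i + kurP N κ θm i t - deriv (θm i) 0| ≤ A := by
      intro i t
      have hP := kurP_bound (t := t) hN hκ hA.le hs 0 (by omega) i
      have h1 := abs_add_le (ν i) (kurP N κ θm i t)
      have h2 := abs_sub (ν i + kurP N κ θm i t) (deriv (θm i) 0)
      norm_num at hP
      linarith [hV i, hw' i]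
    have hz := zeroth hN hκ hA.le hm hs hsz (fun i => by rw [hi, hiz]) hC' he hez t ht
    rw [hEd] at hz
    have hl := kurP_lip hN hκ hz i
    have hdd : Differentiable ℝ (iteratedDeriv 2 (θm i)) := smooth_diff_iter (hs i) 2
    have hy := lin_weak (c := κ * (2 * A)) hm hdd (fun t ht => by
      have e := inert_eq hs he 1 i t ht
      rw [iteratedDeriv_succ] at e
      rw [e, iteratedDeriv_const_add (by omega)]
      have := kurP_bound (t := t) hN hκ hA.le hs 1 (fun k _ j => (bm k j t ht).1) i
      simpa using this) t ht
    have e2 : iteratedDeriv 2 (θm i) = deriv (deriv (θm i)) := by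
      rw [iteratedDeriv_succ, iteratedDeriv_one]
    rw [e2] at hy
    have hy0 : m * |deriv (deriv (θm i)) 0| ≤ A := by
      have := hC' i 0
      rw [← he i 0 le_rfl, add_sub_cancel_right, abs_mul, abs_of_pos hm] at this
      exact this
    have hmy : m * |deriv (deriv (θm i)) t| ≤ A * Real.exp (-t / m) + 2 * A * (m * κ) := by
      calc _ ≤ m * (|deriv (deriv (θm i)) 0| * Real.exp (-t / m) + κ * (2 * A)) := by gcongr
        _ = (m * |deriv (deriv (θm i)) 0|) * Real.exp (-t / m) + 2 * A * (m * κ) := by ring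
        _ ≤ _ := by gcongr
    simp only [zero_add, iteratedDeriv_one]
    have e3 : deriv (θm i) t - deriv (θz i) t =
        (kurP N κ θm i t - kurP N κ θz i t) - m * deriv (deriv (θm i)) t := by
      linarith [he i t ht, hez i t ht]
    rw [e3]
    refine (abs_sub _ _).trans ?_
    rw [abs_mul, abs_of_pos hm]
    norm_num [Nat.factorial]
    have h5 := mul_le_mul_of_nonneg_left hmE hA.le
    have h6 := mul_pos hA hx
    nlinarith
  | succ k =>
    have h1 := (bm (k + 1) i t ht).2 (by omega)
    have h2 := (bz (k + 1) i t ht).2 (by omega)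
    refine (abs_sub _ _).trans ((add_le_add h1 h2).trans ?_)
    have h3 : κ * (((k + 1).factorial : ℝ) * (2 * A) ^ (k + 1)) ≤
        ((k + 1).factorial : ℝ) * 2 ^ (k + 1) * A ^ (k + 1 + 1) * (m * κ * E) := by
      calc _ = ((k + 1).factorial : ℝ) * 2 ^ (k + 1) * A ^ (k + 1) * κ * 1 := by
            rw [mul_pow]; ring
        _ ≤ ((k + 1).factorial : ℝ) * 2 ^ (k + 1) * A ^ (k + 1) * κ * (m * A) := by gcongr
        _ = ((k + 1).factorial : ℝ) * 2 ^ (k + 1) * A ^ (k + 1 + 1) * (m * κ) := by ring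
        _ ≤ _ := by gcongr
    have hf : ((k + 1).factorial : ℝ) ≤ ((k + 1 + 1 + 1).factorial : ℝ) := by
      exact_mod_cast Nat.factorial_le (by omega)
    calc _ ≤ ((k + 1).factorial : ℝ) * 2 ^ (k + 1) * A ^ (k + 1 + 1) *
          (2 * (Real.exp (-t / m) + m * κ * E)) := by
          have : 0 ≤ ((k + 1).factorial : ℝ) * 2 ^ (k + 1) * A ^ (k + 1 + 1) *
            Real.exp (-t / m) := by positivity
          linarith
      _ = ((k + 1).factorial : ℝ) * 2 ^ (k + 1 + 1) * A ^ (k + 1 + 1) *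
          (Real.exp (-t / m) + m * κ * E) := by ring
      _ ≤ _ := by gcongr
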